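/- Define T₂(ix) for x = K(k′)/K(k), k ∈ (0,1), by T₂(ix) = S₂(ix) + 4π³x² ∑_{n=1}^∞ n cosh(nπx)/sinh³(nπx), where S₂(ix) = (4/3)K(k′)[3E(k)+(k²−2)K(k)]. Then 4π³x² ∑_{n=1}^∞ n cosh(nπx)/sinh³(nπx) = (8/(3π))K(k′)²[2E(k)K(k)(2−k²) + K(k)²(k²−1) − 3E(k)²]. -/

import Mathlib

open Real

/-- The complete elliptic integral of the first kind. -/
noncomputable def ellipticK (k : ℝ) : ℝ :=
  ∫ t in (0:ℝ)..1, 1 / Real.sqrt ((1 - t ^ 2) * (1 - k ^ 2 * t ^ 2))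

/-- The complete elliptic integral of the second kind. -/
noncomputable def ellipticE (k : ℝ) : ℝ :=
  ∫ t in (0:ℝ)..1, Real.sqrt ((1 - k ^ 2 * t ^ 2) / (1 - t ^ 2))

/-- The ratio of elliptic integrals with complementary modulus. -/
noncomputable def xRatio (k : ℝ) : ℝ :=
  ellipticK (Real.sqrt (1 - k ^ 2)) / ellipticK k

section

open Set MeasureTheory intervalIntegral Filter Topology

lemma sin_image_Ioo : Real.sin '' Ioo 0 (π / 2) = Ioo 0 1 := by
  ext t
  constructor
  · rintro ⟨θ, ⟨h0, h1⟩, rfl⟩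
    refine ⟨Real.sin_pos_of_pos_of_lt_pi h0 (by linarith [pi_pos]), ?_⟩
    rw [← Real.sin_pi_div_two]
    exact Real.sin_lt_sin_of_lt_of_le_pi_div_two (by linarith [pi_pos]) le_rfl h1
  · rintro ⟨h0, h1⟩
    exact ⟨Real.arcsin t, ⟨Real.arcsin_pos.2 h0, Real.arcsin_lt_pi_div_two.2 h1⟩,
      Real.sin_arcsin (by linarith) h1.le⟩

lemma integral_eq_integral_of_sin {g f : ℝ → ℝ}
    (h : ∀ θ, 0 < Real.cos θ → Real.cos θ * g (Real.sin θ) = f θ) :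
    ∫ t in (0:ℝ)..1, g t = ∫ θ in (0:ℝ)..(π / 2), f θ := by
  rw [integral_of_le zero_le_one, integral_of_le (by positivity), integral_Ioc_eq_integral_Ioo,
    integral_Ioc_eq_integral_Ioo, ← sin_image_Ioo,
    integral_image_eq_integral_abs_deriv_smul (f' := Real.cos) measurableSet_Ioo
      (fun x _ ↦ (Real.hasDerivAt_sin x).hasDerivWithinAt)
      (fun x hx y hy h ↦ Real.injOn_sin ⟨by linarith [hx.1, pi_pos], hx.2.le⟩
        ⟨by linarith [hy.1, pi_pos], hy.2.le⟩ h)]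
  refine setIntegral_congr_fun measurableSet_Ioo fun θ hθ ↦ ?_
  have := Real.cos_pos_of_mem_Ioo ⟨by linarith [hθ.1, pi_pos], hθ.2⟩
  simp [abs_of_pos this, h θ this]

lemma ellipticK_eq_integral_sin (k : ℝ) :
    ellipticK k = ∫ θ in (0:ℝ)..(π / 2), (√(1 - k ^ 2 * Real.sin θ ^ 2))⁻¹ := by
  refine integral_eq_integral_of_sin fun θ this ↦ ?_
  rw [← Real.cos_sq', Real.sqrt_mul (sq_nonneg _), Real.sqrt_sq this.le]
  field_simp

lemma ellipticE_eq_integral_sin (k : ℝ) :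
    ellipticE k = ∫ θ in (0:ℝ)..(π / 2), √(1 - k ^ 2 * Real.sin θ ^ 2) := by
  refine integral_eq_integral_of_sin fun θ this ↦ ?_
  rw [← Real.cos_sq', Real.sqrt_div' _ (sq_nonneg _), Real.sqrt_sq this.le]
  field_simp

lemma one_sub_sq_mul_sin_sq_pos {k : ℝ} (hk : |k| < 1) (θ : ℝ) :
    0 < 1 - k ^ 2 * Real.sin θ ^ 2 := by
  have h1 : k ^ 2 < 1 := (sq_lt_one_iff_abs_lt_one k).2 hk
  nlinarith [Real.sin_sq_le_one θ, sq_nonneg (Real.sin θ), sq_nonneg k]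

lemma continuous_inv_sqrt_one_sub {k : ℝ} (hk : |k| < 1) :
    Continuous fun θ ↦ (√(1 - k ^ 2 * Real.sin θ ^ 2))⁻¹ :=
  Continuous.inv₀ (by fun_prop) fun θ ↦ (Real.sqrt_pos.2 (one_sub_sq_mul_sin_sq_pos hk θ)).ne'

lemma ellipticK_pos {k : ℝ} (hk : |k| < 1) : 0 < ellipticK k := by
  rw [ellipticK_eq_integral_sin]
  exact intervalIntegral_pos_of_pos ((continuous_inv_sqrt_one_sub hk).intervalIntegrable _ _)
    (fun θ ↦ inv_pos.2 (Real.sqrt_pos.2 (one_sub_sq_mul_sin_sq_pos hk θ))) (by positivity)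

/-- Differentiation of `∫ f(k, θ) dθ` in the parameter, with `f'` jointly continuous. -/
lemma hasDerivAt_integral_of_continuousOn {f f' : ℝ → ℝ → ℝ} {s : Set ℝ} (hs : IsOpen s)
    {a b : ℝ}
    (hf : ∀ k ∈ s, ∀ θ, HasDerivAt (fun x ↦ f x θ) (f' k θ) k)
    (hc : ∀ k ∈ s, Continuous (f k))
    (hc' : ContinuousOn (fun p : ℝ × ℝ ↦ f' p.1 p.2) (s ×ˢ univ)) {k : ℝ} (hk : k ∈ s) :
    HasDerivAt (fun x ↦ ∫ θ in a..b, f x θ) (∫ θ in a..b, f' k θ) k := by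
  obtain ⟨ε, hε, hball⟩ := Metric.nhds_basis_closedBall.mem_iff.1 (hs.mem_nhds hk)
  obtain ⟨C, hC⟩ := ((isCompact_closedBall k ε).prod (isCompact_uIcc (a := a) (b := b))).exists_bound_of_continuousOn
    (hc'.mono (prod_mono hball (subset_univ _)))
  refine (intervalIntegral.hasDerivAt_integral_of_dominated_loc_of_deriv_le
    (bound := fun _ ↦ C) (Metric.closedBall_mem_nhds k hε) ?_ ?_ ?_ ?_ ?_ ?_).2
  · filter_upwards [hs.mem_nhds hk] with x hx
    exact (hc x hx).aestronglyMeasurable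
  · exact (hc k hk).intervalIntegrable _ _
  · refine Continuous.aestronglyMeasurable ?_
    rw [← continuousOn_univ]
    exact hc'.comp (f := fun θ ↦ (k, θ)) (by fun_prop) (fun θ _ ↦ ⟨hk, mem_univ _⟩)
  · refine .of_forall fun θ hθ x hx ↦ hC (x, θ) ⟨hx, uIoc_subset_uIcc hθ⟩
  · exact intervalIntegrable_const
  · exact .of_forall fun θ _ x hx ↦ hf x (hball hx) θ

lemma isOpen_abs_lt_one : IsOpen {k : ℝ | |k| < 1} := isOpen_lt (by fun_prop) (by fun_prop)

lemma hasDerivAt_one_sub_sq_mul (k s : ℝ) :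
    HasDerivAt (fun x ↦ 1 - x ^ 2 * s ^ 2) (-(2 * k * s ^ 2)) k := by
  convert! ((hasDerivAt_pow 2 k).mul_const (s ^ 2)).const_sub 1 using 1
  norm_num

/-- `dE/dk = (E - K) / k`. -/
lemma hasDerivAt_ellipticE {k : ℝ} (hk : |k| < 1) (hk0 : k ≠ 0) :
    HasDerivAt ellipticE ((ellipticE k - ellipticK k) / k) k := by
  have h := hasDerivAt_integral_of_continuousOn (a := 0) (b := π / 2)
    (f := fun k θ ↦ √(1 - k ^ 2 * Real.sin θ ^ 2))
    (f' := fun k θ ↦ -(2 * k * Real.sin θ ^ 2) / (2 * √(1 - k ^ 2 * Real.sin θ ^ 2)))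
    isOpen_abs_lt_one
    (fun x hx θ ↦ (hasDerivAt_one_sub_sq_mul x _).sqrt (one_sub_sq_mul_sin_sq_pos hx θ).ne')
    (fun x _ ↦ by fun_prop)
    (ContinuousOn.div (by fun_prop) (by fun_prop) fun p hp ↦
      (mul_pos two_pos (Real.sqrt_pos.2 (one_sub_sq_mul_sin_sq_pos hp.1 _))).ne') hk
  rw [funext ellipticE_eq_integral_sin]
  convert h using 1
  rw [ellipticK_eq_integral_sin, ← integral_sub
    (Continuous.intervalIntegrable (by fun_prop) _ _)
    ((continuous_inv_sqrt_one_sub hk).intervalIntegrable _ _), ← intervalIntegral.integral_div]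
  refine integral_congr fun θ _ ↦ ?_
  have hp := one_sub_sq_mul_sin_sq_pos hk θ
  have h1 := Real.sqrt_pos.2 hp
  have h2 := Real.sq_sqrt hp.le
  field_simp
  linear_combination h2

/-- `∫ Δ⁻³ = E / (1 - k²)`. -/
lemma integral_inv_sqrt_pow_three {k : ℝ} (hk : |k| < 1) :
    (1 - k ^ 2) * ∫ θ in (0:ℝ)..(π / 2), (√(1 - k ^ 2 * Real.sin θ ^ 2))⁻¹ ^ 3 = ellipticE k := by
  have hc := continuous_inv_sqrt_one_sub hk
  have key : ∫ θ in (0:ℝ)..(π / 2), (√(1 - k ^ 2 * Real.sin θ ^ 2) -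
      (1 - k ^ 2) * (√(1 - k ^ 2 * Real.sin θ ^ 2))⁻¹ ^ 3) = 0 := by
    rw [integral_eq_sub_of_hasDerivAt (f := fun θ ↦
      k ^ 2 * (Real.sin θ * Real.cos θ / √(1 - k ^ 2 * Real.sin θ ^ 2)))]
    · simp
    · intro θ _
      have hp := one_sub_sq_mul_sin_sq_pos hk θ
      have h1 := Real.sqrt_pos.2 hp
      have h2 := Real.sq_sqrt hp.le
      have hs : HasDerivAt (fun θ ↦ √(1 - k ^ 2 * Real.sin θ ^ 2))
          (-(k ^ 2 * (2 * Real.sin θ * Real.cos θ)) / (2 * √(1 - k ^ 2 * Real.sin θ ^ 2))) θ := by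
        refine HasDerivAt.sqrt ?_ hp.ne'
        convert! (((Real.hasDerivAt_sin θ).pow 2).const_mul (k ^ 2)).const_sub 1 using 1
        norm_num
      convert! (((Real.hasDerivAt_sin θ).mul (Real.hasDerivAt_cos θ)).div hs h1.ne').const_mul
        (k ^ 2) using 1
      have h3 := Real.cos_sq' θ
      set r := √(1 - k ^ 2 * Real.sin θ ^ 2)
      have h4 : r ^ 4 = (1 - k ^ 2 * Real.sin θ ^ 2) ^ 2 := by rw [← h2]; ring
      simp only [Pi.mul_apply]
      field_simp
      rw [h4, h2, h3]
      ring
    · exact Continuous.intervalIntegrable (by fun_prop) _ _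
  rw [integral_sub (Continuous.intervalIntegrable (by fun_prop) _ _)
    (Continuous.intervalIntegrable (by fun_prop) _ _), intervalIntegral.integral_const_mul, sub_eq_zero] at key
  rw [ellipticE_eq_integral_sin, key]

lemma hasDerivAt_integral_inv_sqrt {k : ℝ} (hk : |k| < 1) :
    HasDerivAt (fun k ↦ ∫ θ in (0:ℝ)..(π / 2), (√(1 - k ^ 2 * Real.sin θ ^ 2))⁻¹)
      (∫ θ in (0:ℝ)..(π / 2), -(-(2 * k * Real.sin θ ^ 2) /
        (2 * √(1 - k ^ 2 * Real.sin θ ^ 2))) / √(1 - k ^ 2 * Real.sin θ ^ 2) ^ 2) k :=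
  hasDerivAt_integral_of_continuousOn (a := 0) (b := π / 2)
    (f := fun k θ ↦ (√(1 - k ^ 2 * Real.sin θ ^ 2))⁻¹)
    (f' := fun k θ ↦ -(-(2 * k * Real.sin θ ^ 2) / (2 * √(1 - k ^ 2 * Real.sin θ ^ 2))) /
      √(1 - k ^ 2 * Real.sin θ ^ 2) ^ 2)
    isOpen_abs_lt_one
    (fun x hx θ ↦ ((hasDerivAt_one_sub_sq_mul x _).sqrt
      (one_sub_sq_mul_sin_sq_pos hx θ).ne').fun_inv
        (Real.sqrt_pos.2 (one_sub_sq_mul_sin_sq_pos hx _)).ne')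
    (fun x hx ↦ continuous_inv_sqrt_one_sub hx)
    (ContinuousOn.div (ContinuousOn.neg (ContinuousOn.div (by fun_prop) (by fun_prop) fun p hp ↦
      (mul_pos two_pos (Real.sqrt_pos.2 (one_sub_sq_mul_sin_sq_pos hp.1 _))).ne')) (by fun_prop)
      fun p hp ↦ (pow_pos (Real.sqrt_pos.2 (one_sub_sq_mul_sin_sq_pos hp.1 _)) 2).ne') hk

/-- `dK/dk = (E - (1 - k²) K) / (k (1 - k²))`. -/
lemma hasDerivAt_ellipticK {k : ℝ} (hk : |k| < 1) (hk0 : k ≠ 0) :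
    HasDerivAt ellipticK ((ellipticE k - (1 - k ^ 2) * ellipticK k) / (k * (1 - k ^ 2))) k := by
  have h := hasDerivAt_integral_inv_sqrt hk
  have hc := continuous_inv_sqrt_one_sub hk
  have hk1 : 1 - k ^ 2 ≠ 0 := by
    have h1 : k ^ 2 < 1 := (sq_lt_one_iff_abs_lt_one k).2 hk
    linarith
  rw [funext ellipticK_eq_integral_sin]
  convert h using 1
  rw [← integral_inv_sqrt_pow_three hk, ← mul_sub, mul_comm k, mul_div_mul_left _ _ hk1,
    ← integral_sub
    (Continuous.intervalIntegrable (by fun_prop) _ _)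
    (Continuous.intervalIntegrable (by fun_prop) _ _), ← intervalIntegral.integral_div]
  refine integral_congr fun θ _ ↦ ?_
  have hp := one_sub_sq_mul_sin_sq_pos hk θ
  have h1 := Real.sqrt_pos.2 hp
  have h2 := Real.sq_sqrt hp.le
  field_simp
  linear_combination -h2

lemma sqrt_one_sub_sq_mem_Ioo {k : ℝ} (hk : k ∈ Ioo (0:ℝ) 1) : √(1 - k ^ 2) ∈ Ioo (0:ℝ) 1 := by
  have h : 0 < 1 - k ^ 2 := by nlinarith [hk.1, hk.2]
  exact ⟨Real.sqrt_pos.2 h, (Real.sqrt_lt' one_pos).2 (by nlinarith [hk.1])⟩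

lemma hasDerivAt_sqrt_one_sub_sq {k : ℝ} (hk : k ∈ Ioo (0:ℝ) 1) :
    HasDerivAt (fun k ↦ √(1 - k ^ 2)) (-k / √(1 - k ^ 2)) k := by
  have h : 0 < 1 - k ^ 2 := by nlinarith [hk.1, hk.2]
  convert! HasDerivAt.sqrt ((hasDerivAt_pow 2 k).const_sub 1) h.ne' using 1
  have := (Real.sqrt_pos.2 h).ne'
  field_simp
  norm_num
  ring

lemma abs_lt_one_of_mem_Ioo {k : ℝ} (hk : k ∈ Ioo (0:ℝ) 1) : |k| < 1 :=
  abs_lt.2 ⟨by linarith [hk.1], hk.2⟩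

/-- The left-hand side of Legendre's relation. -/
noncomputable def legendreW (k : ℝ) : ℝ :=
  ellipticE k * ellipticK √(1 - k ^ 2) + ellipticE √(1 - k ^ 2) * ellipticK k -
    ellipticK k * ellipticK √(1 - k ^ 2)

lemma hasDerivAt_legendreW {k : ℝ} (hk : k ∈ Ioo (0:ℝ) 1) : HasDerivAt legendreW 0 k := by
  have hl := sqrt_one_sub_sq_mem_Ioo hk
  have hk' := abs_lt_one_of_mem_Ioo hk
  have hl' := abs_lt_one_of_mem_Ioo hl
  have dl := hasDerivAt_sqrt_one_sub_sq hk
  have dE := hasDerivAt_ellipticE hk' hk.1.ne'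
  have dK := hasDerivAt_ellipticK hk' hk.1.ne'
  have dE' := (hasDerivAt_ellipticE hl' hl.1.ne').comp k dl
  have dK' := (hasDerivAt_ellipticK hl' hl.1.ne').comp k dl
  convert! ((dE.mul dK').add (dE'.mul dK)).sub (dK.mul dK') using 1
  have h : 0 < 1 - k ^ 2 := by nlinarith [hk.1, hk.2]
  have h2 := Real.sq_sqrt h.le
  have hk0 := hk.1.ne'
  have hl0 := hl.1.ne'
  simp only [Function.comp_def]
  set l := √(1 - k ^ 2)
  rw [show 1 - l ^ 2 = k ^ 2 by linarith, ← h2]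
  field_simp
  rw [show k ^ 2 = 1 - l ^ 2 by linarith]
  ring

lemma ellipticK_sqrt_le {k : ℝ} (hk : k ∈ Ioo (0:ℝ) 1) :
    ellipticK √(1 - k ^ 2) ≤ π / (2 * k) := by
  have hl := abs_lt_one_of_mem_Ioo (sqrt_one_sub_sq_mem_Ioo hk)
  have h : 0 < 1 - k ^ 2 := by nlinarith [hk.1, hk.2]
  rw [ellipticK_eq_integral_sin]
  refine (integral_mono_on (g := fun _ ↦ k⁻¹) (by positivity)
    ((continuous_inv_sqrt_one_sub hl).intervalIntegrable _ _) intervalIntegrable_const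
    fun θ _ ↦ ?_).trans_eq ?_
  · refine inv_anti₀ hk.1 (Real.le_sqrt_of_sq_le ?_)
    rw [Real.sq_sqrt h.le]
    nlinarith [Real.sin_sq_le_one θ]
  · have := hk.1.ne'
    simp
    field_simp

lemma ellipticK_sub_ellipticE_bounds {k : ℝ} (hk : k ∈ Ioo (0:ℝ) 1) :
    0 ≤ ellipticK k - ellipticE k ∧ ellipticK k - ellipticE k ≤ k ^ 2 * ellipticK k := by
  have hk' := abs_lt_one_of_mem_Ioo hk
  have hi := (continuous_inv_sqrt_one_sub hk').intervalIntegrable 0 (π / 2) (μ := volume)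
  have hj : IntervalIntegrable (fun θ ↦ √(1 - k ^ 2 * Real.sin θ ^ 2)) volume 0 (π / 2) :=
    Continuous.intervalIntegrable (by fun_prop) _ _
  rw [ellipticK_eq_integral_sin, ellipticE_eq_integral_sin, ← integral_sub hi hj,
    ← intervalIntegral.integral_const_mul]
  have key : ∀ θ, (√(1 - k ^ 2 * Real.sin θ ^ 2))⁻¹ - √(1 - k ^ 2 * Real.sin θ ^ 2) =
      k ^ 2 * Real.sin θ ^ 2 * (√(1 - k ^ 2 * Real.sin θ ^ 2))⁻¹ := fun θ ↦ by
    have hp := one_sub_sq_mul_sin_sq_pos hk' θ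
    have h1 := Real.sqrt_pos.2 hp
    have h2 := Real.sq_sqrt hp.le
    field_simp
    linarith
  simp_rw [key]
  constructor
  · exact integral_nonneg (by positivity) fun θ _ ↦ by positivity
  · refine integral_mono_on (by positivity) ?_ (hi.const_mul _) fun θ _ ↦ ?_
    · exact Continuous.intervalIntegrable
        (by have := continuous_inv_sqrt_one_sub hk'; fun_prop) _ _
    · have := Real.sin_sq_le_one θ
      have : k ^ 2 * Real.sin θ ^ 2 ≤ k ^ 2 := by nlinarith [sq_nonneg k]
      gcongr

lemma ellipticK_zero : ellipticK 0 = π / 2 := by simp [ellipticK_eq_integral_sin]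

lemma ellipticE_one : ellipticE 1 = 1 := by
  rw [ellipticE_eq_integral_sin]
  trans ∫ θ in (0:ℝ)..(π / 2), Real.cos θ
  · refine integral_congr fun θ hθ ↦ ?_
    rw [uIcc_of_le (by positivity)] at hθ
    have := Real.cos_nonneg_of_mem_Icc ⟨by linarith [hθ.1, pi_pos], hθ.2⟩
    simp only [one_pow, one_mul]
    rw [← Real.cos_sq', Real.sqrt_sq this]
  · simp

lemma continuous_ellipticE : Continuous ellipticE := by
  rw [funext ellipticE_eq_integral_sin]
  exact continuous_parametric_intervalIntegral_of_continuous' (by fun_prop) _ _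

lemma continuousAt_ellipticK {k : ℝ} (hk : |k| < 1) : ContinuousAt ellipticK k := by
  rw [funext ellipticK_eq_integral_sin]
  exact (hasDerivAt_integral_inv_sqrt hk).continuousAt

lemma tendsto_legendreW : Tendsto legendreW (𝓝[>] 0) (𝓝 (π / 2)) := by
  have hIoo : ∀ᶠ k in 𝓝[>] (0:ℝ), k ∈ Ioo (0:ℝ) 1 := Ioo_mem_nhdsGT one_pos
  have hK : Tendsto ellipticK (𝓝[>] 0) (𝓝 (π / 2)) := by
    rw [← ellipticK_zero]
    exact (continuousAt_ellipticK (by simp)).tendsto.mono_left nhdsWithin_le_nhds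
  have hE : Tendsto (fun k ↦ ellipticE √(1 - k ^ 2)) (𝓝[>] 0) (𝓝 1) := by
    have h : Continuous fun k ↦ ellipticE √(1 - k ^ 2) := continuous_ellipticE.comp (by fun_prop)
    convert (h.tendsto 0).mono_left nhdsWithin_le_nhds using 2
    simp [ellipticE_one]
  have h0 : Tendsto (fun k ↦ (ellipticK k - ellipticE k) * ellipticK √(1 - k ^ 2))
      (𝓝[>] 0) (𝓝 0) := by
    have hid : Tendsto (fun k : ℝ ↦ k) (𝓝[>] 0) (𝓝 0) :=
      (continuous_id.tendsto 0).mono_left nhdsWithin_le_nhds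
    refine squeeze_zero' ?_ ?_ (g := fun k ↦ k * ellipticK k * (π / 2)) ?_
    · filter_upwards [hIoo] with k hk
      exact mul_nonneg (ellipticK_sub_ellipticE_bounds hk).1
        (ellipticK_pos (abs_lt_one_of_mem_Ioo (sqrt_one_sub_sq_mem_Ioo hk))).le
    · filter_upwards [hIoo] with k hk
      have hK := (ellipticK_pos (abs_lt_one_of_mem_Ioo hk)).le
      refine (mul_le_mul (ellipticK_sub_ellipticE_bounds hk).2 (ellipticK_sqrt_le hk)
        (ellipticK_pos (abs_lt_one_of_mem_Ioo (sqrt_one_sub_sq_mem_Ioo hk))).le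
        (by positivity)).trans_eq ?_
      have := hk.1.ne'
      field_simp
    · simpa using (hid.mul hK).mul_const (π / 2)
  have := (hE.mul hK).sub h0
  rw [one_mul, sub_zero] at this
  refine this.congr fun k ↦ ?_
  rw [legendreW]
  ring

/-- **Legendre's relation.** -/
lemma legendreW_eq {k : ℝ} (hk : k ∈ Ioo (0:ℝ) 1) : legendreW k = π / 2 := by
  have hc : ∀ x ∈ Ioo (0:ℝ) 1, legendreW x = legendreW k := fun x hx ↦
    isOpen_Ioo.is_const_of_deriv_eq_zero isPreconnected_Ioo
      (fun y hy ↦ (hasDerivAt_legendreW hy).differentiableAt.differentiableWithinAt)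
      (fun y hy ↦ (hasDerivAt_legendreW hy).deriv) hx hk
  refine tendsto_nhds_unique (tendsto_const_nhds.congr' ?_) tendsto_legendreW
  filter_upwards [Ioo_mem_nhdsGT (one_pos (α := ℝ))] with x hx
  exact (hc x hx).symm

lemma hasDerivAt_xRatio {k : ℝ} (hk : k ∈ Ioo (0:ℝ) 1) :
    HasDerivAt xRatio (-(π / (2 * k * (1 - k ^ 2) * ellipticK k ^ 2))) k := by
  have hl := sqrt_one_sub_sq_mem_Ioo hk
  have hk' := abs_lt_one_of_mem_Ioo hk
  have hl' := abs_lt_one_of_mem_Ioo hl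
  have dl := hasDerivAt_sqrt_one_sub_sq hk
  have dK := hasDerivAt_ellipticK hk' hk.1.ne'
  have dK' := (hasDerivAt_ellipticK hl' hl.1.ne').comp k dl
  have hK := (ellipticK_pos hk').ne'
  convert! dK'.div dK hK using 1
  have h : 0 < 1 - k ^ 2 := by nlinarith [hk.1, hk.2]
  have h2 := Real.sq_sqrt h.le
  have hk0 := hk.1.ne'
  have hl0 := hl.1.ne'
  have hW := legendreW_eq hk
  rw [legendreW] at hW
  simp only [Function.comp_def]
  set l := √(1 - k ^ 2)
  rw [show π = 2 * (π / 2) by ring, ← hW, show 1 - l ^ 2 = k ^ 2 by linarith, ← h2]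
  field_simp
  rw [show k ^ 2 = 1 - l ^ 2 by linarith]
  ring

/-- The integral whose invariance under `(a, b) ↦ ((a + b) / 2, √(ab))` is Landen's
transformation. -/
noncomputable def agmIntegral (a b : ℝ) : ℝ :=
  ∫ t in Ioi (0:ℝ), (√((t ^ 2 + a ^ 2) * (t ^ 2 + b ^ 2)))⁻¹

lemma sub_div_image_Ioi {c : ℝ} (hc : 0 < c) :
    (fun t ↦ (t - c / t) / 2) '' Ioi 0 = univ := by
  refine eq_univ_of_forall fun u ↦ ?_
  have h1 : |u| < √(u ^ 2 + c) := by
    rw [← Real.sqrt_sq_eq_abs]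
    exact Real.sqrt_lt_sqrt (sq_nonneg _) (by linarith)
  have h2 : 0 < u + √(u ^ 2 + c) := by linarith [neg_abs_le u]
  refine ⟨u + √(u ^ 2 + c), h2, ?_⟩
  have h3 := Real.sq_sqrt (show 0 ≤ u ^ 2 + c by positivity)
  simp only
  field_simp
  linear_combination h3

lemma injOn_sub_div {c : ℝ} (hc : 0 < c) : InjOn (fun t ↦ (t - c / t) / 2) (Ioi 0) := by
  intro x hx y hy h
  have hx' : (0:ℝ) < x := hx
  have hy' : (0:ℝ) < y := hy
  simp only at h
  field_simp at h
  have : (x - y) * (x * y + c) = 0 := by linear_combination h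
  rcases mul_eq_zero.1 this with h | h
  · linarith
  · nlinarith [mul_pos hx' hy']

lemma agmIntegral_landen {a b : ℝ} (ha : 0 < a) (hb : 0 < b) :
    agmIntegral ((a + b) / 2) √(a * b) = agmIntegral a b := by
  have hab := mul_pos ha hb
  have h1 := integral_comp_abs
    (f := fun u ↦ (√((u ^ 2 + ((a + b) / 2) ^ 2) * (u ^ 2 + √(a * b) ^ 2)))⁻¹)
  simp only [sq_abs] at h1
  have h2 := integral_image_eq_integral_abs_deriv_smul (s := Ioi 0)
    (f := fun t ↦ (t - a * b / t) / 2) (f' := fun t ↦ (1 + a * b / t ^ 2) / 2)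
    measurableSet_Ioi (fun t ht ↦ by
      have ht' : t ≠ 0 := (mem_Ioi.1 ht).ne'
      refine HasDerivAt.hasDerivWithinAt ?_
      convert! (((hasDerivAt_id t).sub ((hasDerivAt_inv ht').const_mul (a * b))).div_const 2)
        using 1
      field_simp
      ring) (injOn_sub_div hab)
    (fun u ↦ (√((u ^ 2 + ((a + b) / 2) ^ 2) * (u ^ 2 + √(a * b) ^ 2)))⁻¹)
  rw [sub_div_image_Ioi hab, setIntegral_univ, h1] at h2
  have h3 : ∀ t ∈ Ioi (0:ℝ), |(1 + a * b / t ^ 2) / 2| •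
      (√((((t - a * b / t) / 2) ^ 2 + ((a + b) / 2) ^ 2) *
        (((t - a * b / t) / 2) ^ 2 + √(a * b) ^ 2)))⁻¹ =
      2 * (√((t ^ 2 + a ^ 2) * (t ^ 2 + b ^ 2)))⁻¹ := by
    intro t ht
    have ht' : 0 < t := ht
    rw [Real.sq_sqrt hab.le, abs_of_pos (by positivity), smul_eq_mul,
      show (((t - a * b / t) / 2) ^ 2 + ((a + b) / 2) ^ 2) * (((t - a * b / t) / 2) ^ 2 + a * b) =
        ((t ^ 2 + a * b) / (4 * t ^ 2)) ^ 2 * ((t ^ 2 + a ^ 2) * (t ^ 2 + b ^ 2)) by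
          field_simp
          ring, Real.sqrt_mul (sq_nonneg _), Real.sqrt_sq (by positivity), mul_inv]
    field_simp
    ring
  rw [setIntegral_congr_fun measurableSet_Ioi h3, MeasureTheory.integral_const_mul] at h2
  exact mul_left_cancel₀ two_ne_zero h2

lemma tan_image_Ioo {c : ℝ} (hc : 0 < c) :
    (fun θ ↦ c * Real.tan θ) '' Ioo 0 (π / 2) = Ioi 0 := by
  ext t
  constructor
  · rintro ⟨θ, ⟨h0, h1⟩, rfl⟩
    exact mul_pos hc (Real.tan_pos_of_pos_of_lt_pi_div_two h0 h1)
  · intro ht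
    refine ⟨Real.arctan (t / c), ⟨Real.arctan_pos.2 (div_pos ht hc),
      Real.arctan_lt_pi_div_two _⟩, ?_⟩
    simp only [Real.tan_arctan]
    field_simp

lemma agmIntegral_eq_ellipticK {s k : ℝ} (hs : 0 < s) (hk : k ∈ Ioo (0:ℝ) 1) :
    agmIntegral s (s * √(1 - k ^ 2)) = ellipticK k / s := by
  have h : 0 < 1 - k ^ 2 := by nlinarith [hk.1, hk.2]
  have hl := (sqrt_one_sub_sq_mem_Ioo hk).1
  have h2 := Real.sq_sqrt h.le
  rw [ellipticK_eq_integral_sin, ← intervalIntegral.integral_div, integral_of_le (by positivity),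
    integral_Ioc_eq_integral_Ioo]
  set l := √(1 - k ^ 2)
  have hcos : ∀ θ ∈ Ioo 0 (π / 2), 0 < Real.cos θ := fun θ hθ ↦
    Real.cos_pos_of_mem_Ioo ⟨by linarith [hθ.1, pi_pos], hθ.2⟩
  rw [agmIntegral, ← tan_image_Ioo (mul_pos hs hl),
    integral_image_eq_integral_abs_deriv_smul measurableSet_Ioo
      (fun θ hθ ↦ ((Real.hasDerivAt_tan (hcos θ hθ).ne').const_mul _).hasDerivWithinAt)
      (fun x hx y hy hxy ↦ Real.injOn_tan ⟨by linarith [hx.1, pi_pos], hx.2⟩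
        ⟨by linarith [hy.1, pi_pos], hy.2⟩ (mul_left_cancel₀ (mul_pos hs hl).ne' hxy))]
  refine setIntegral_congr_fun measurableSet_Ioo fun θ hθ ↦ ?_
  have hc := hcos θ hθ
  have hp := one_sub_sq_mul_sin_sq_pos (abs_lt_one_of_mem_Ioo hk) θ
  have h3 := Real.sin_sq_add_cos_sq θ
  have hr := Real.sqrt_pos.2 hp
  simp only [smul_eq_mul]
  rw [abs_of_pos (by positivity), Real.tan_eq_sin_div_cos,
    show ((s * l * (Real.sin θ / Real.cos θ)) ^ 2 + s ^ 2) *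
      ((s * l * (Real.sin θ / Real.cos θ)) ^ 2 + (s * l) ^ 2) =
      (s ^ 2 * l / Real.cos θ ^ 2) ^ 2 * (1 - k ^ 2 * Real.sin θ ^ 2) by
        field_simp
        rw [h2]
        linear_combination (1 + (1 - k ^ 2) * Real.sin θ ^ 2 + Real.cos θ ^ 2) * h3,
    Real.sqrt_mul (sq_nonneg _), Real.sqrt_sq (by positivity)]
  field_simp

end

section

open Set MeasureTheory intervalIntegral Filter Topology
open HurwitzZeta

/-- The theta constant `θ₂` at `τ = ix`. -/
noncomputable def theta2 (x : ℝ) : ℝ := evenKernel ((1 / 2 : ℝ) : UnitAddCircle) x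

/-- The theta constant `θ₃` at `τ = ix`. -/
noncomputable def theta3 (x : ℝ) : ℝ := evenKernel ((0 : ℝ) : UnitAddCircle) x

/-- The theta constant `θ₄` at `τ = ix`. -/
noncomputable def theta4 (x : ℝ) : ℝ := cosKernel ((1 / 2 : ℝ) : UnitAddCircle) x

lemma hasSum_theta2 {x : ℝ} (hx : 0 < x) :
    HasSum (fun n : ℤ ↦ rexp (-π * (n + 1 / 2) ^ 2 * x)) (theta2 x) :=
  hasSum_int_evenKernel _ hx

lemma hasSum_theta3 {x : ℝ} (hx : 0 < x) :
    HasSum (fun n : ℤ ↦ rexp (-π * n ^ 2 * x)) (theta3 x) := by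
  have := hasSum_int_evenKernel 0 hx
  simp only [add_zero] at this
  exact this

lemma hasSum_theta4 {x : ℝ} (hx : 0 < x) :
    HasSum (fun n : ℤ ↦ (-1) ^ n * rexp (-π * n ^ 2 * x)) (theta4 x) := by
  rw [← Complex.hasSum_ofReal]
  refine (hasSum_int_cosKernel (1 / 2) hx).congr_fun fun n ↦ ?_
  have : Complex.exp (2 * π * Complex.I * (1 / 2 : ℝ) * n) = (-1) ^ n := by
    rw [← Complex.exp_pi_mul_I, ← Complex.exp_int_mul]
    push_cast
    ring_nf
  rw [this]
  push_cast
  rfl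

/-- Splitting a sum over `ℤ × ℤ` according to the parity of the sum of the coordinates. -/
lemma hasSum_int_prod_of_parity {F : ℤ × ℤ → ℝ} {A B : ℝ}
    (hA : HasSum (fun p : ℤ × ℤ ↦ F (p.1 + p.2, p.1 - p.2)) A)
    (hB : HasSum (fun p : ℤ × ℤ ↦ F (p.1 + p.2 + 1, p.1 - p.2)) B) : HasSum F (A + B) := by
  have i1 : Function.Injective fun p : ℤ × ℤ ↦ (p.1 + p.2, p.1 - p.2) := by
    rintro ⟨a, b⟩ ⟨c, d⟩ h
    simp only [Prod.mk.injEq] at h ⊢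
    omega
  have i2 : Function.Injective fun p : ℤ × ℤ ↦ (p.1 + p.2 + 1, p.1 - p.2) := by
    rintro ⟨a, b⟩ ⟨c, d⟩ h
    simp only [Prod.mk.injEq] at h ⊢
    omega
  refine HasSum.add_isCompl ?_ (i1.hasSum_range_iff.2 hA) (i2.hasSum_range_iff.2 hB)
  refine ⟨Set.disjoint_iff.2 ?_, codisjoint_iff.2 (eq_univ_of_forall ?_)⟩
  · rintro ⟨m, n⟩ ⟨⟨⟨a, b⟩, h⟩, ⟨⟨c, d⟩, h'⟩⟩
    simp only [Prod.mk.injEq] at h h'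
    omega
  · rintro ⟨m, n⟩
    rcases Int.even_or_odd' (m + n) with ⟨c, hc | hc⟩
    · exact Or.inl ⟨(c, m - c), by simp only [Prod.mk.injEq]; omega⟩
    · exact Or.inr ⟨(c, m - c - 1), by simp only [Prod.mk.injEq]; omega⟩

lemma HasSum.mul_prod {f g : ℤ → ℝ} {a b : ℝ} (hf : HasSum f a) (hg : HasSum g b) :
    HasSum (fun p : ℤ × ℤ ↦ f p.1 * g p.2) (a * b) :=
  hf.mul hg (summable_mul_of_summable_norm hf.summable.norm hg.summable.norm)

lemma theta3_sq {x : ℝ} (hx : 0 < x) :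
    theta3 x ^ 2 = theta3 (2 * x) ^ 2 + theta2 (2 * x) ^ 2 := by
  have h2x : 0 < 2 * x := by positivity
  rw [sq, sq, sq]
  refine ((hasSum_theta3 hx).mul_prod (hasSum_theta3 hx)).unique
    (hasSum_int_prod_of_parity ?_ ?_)
  · convert (hasSum_theta3 h2x).mul_prod (hasSum_theta3 h2x) using 2 with p
    simp only [← Real.exp_add]
    push_cast
    ring_nf
  · convert (hasSum_theta2 h2x).mul_prod (hasSum_theta2 h2x) using 2 with p
    simp only [← Real.exp_add]
    push_cast
    ring_nf

lemma neg_one_zpow_mul_self (n : ℤ) : (-1 : ℝ) ^ n * (-1) ^ n = 1 := by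
  rw [← mul_zpow]
  simp

lemma neg_one_zpow_sub (m n : ℤ) : (-1 : ℝ) ^ (m - n) = (-1) ^ m * (-1) ^ n := by
  rw [zpow_sub₀ (by norm_num), div_eq_iff (by positivity), mul_assoc, neg_one_zpow_mul_self,
    mul_one]

lemma theta4_sq {x : ℝ} (hx : 0 < x) :
    theta4 x ^ 2 = theta3 (2 * x) ^ 2 - theta2 (2 * x) ^ 2 := by
  have h2x : 0 < 2 * x := by positivity
  rw [sub_eq_add_neg, sq, sq, sq]
  refine ((hasSum_theta4 hx).mul_prod (hasSum_theta4 hx)).unique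
    (hasSum_int_prod_of_parity ?_ ?_)
  · convert (hasSum_theta3 h2x).mul_prod (hasSum_theta3 h2x) using 2 with p
    rw [neg_one_zpow_sub, zpow_add₀ (by norm_num), mul_mul_mul_comm, mul_mul_mul_comm ((-1) ^ p.1),
      neg_one_zpow_mul_self, neg_one_zpow_mul_self, one_mul, one_mul, ← Real.exp_add, ← Real.exp_add]
    push_cast
    ring_nf
  · refine ((hasSum_theta2 h2x).mul_prod (hasSum_theta2 h2x)).neg.congr_fun fun p ↦ ?_
    rw [neg_one_zpow_sub, zpow_add₀ (by norm_num), zpow_add₀ (by norm_num), zpow_one,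
      mul_mul_mul_comm, mul_neg_one, neg_mul, mul_mul_mul_comm ((-1) ^ p.1),
      neg_one_zpow_mul_self, neg_one_zpow_mul_self, one_mul, neg_one_mul, ← Real.exp_add, ← Real.exp_add]
    push_cast
    ring_nf

lemma hasSum_alternating_theta2 {x : ℝ} (hx : 0 < x) :
    HasSum (fun n : ℤ ↦ (-1) ^ n * rexp (-π * (n + 1 / 2) ^ 2 * x)) 0 := by
  have hs : Summable (fun n : ℤ ↦ (-1) ^ n * rexp (-π * (n + 1 / 2) ^ 2 * x)) := by
    refine .of_norm ?_
    simpa using (hasSum_theta2 hx).summable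
  obtain ⟨s, hs⟩ := hs
  have h := ((Equiv.subLeft (-1 : ℤ)).hasSum_iff).2 hs
  have h' : HasSum (fun n : ℤ ↦ (-1) ^ n * rexp (-π * (n + 1 / 2) ^ 2 * x)) (-s) := by
    refine h.neg.congr_fun fun n ↦ ?_
    simp only [Function.comp_apply, Equiv.subLeft_apply, neg_one_zpow_sub]
    push_cast
    simp only [zpow_neg, zpow_one]
    ring_nf
  have := hs.unique h'
  rwa [show s = 0 by linarith] at hs

lemma theta3_mul_theta4 {x : ℝ} (hx : 0 < x) : theta3 x * theta4 x = theta4 (2 * x) ^ 2 := by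
  have h2x : 0 < 2 * x := by positivity
  rw [← add_zero (theta4 (2 * x) ^ 2), ← zero_mul (0:ℝ), sq]
  refine ((hasSum_theta3 hx).mul_prod (hasSum_theta4 hx)).unique
    (hasSum_int_prod_of_parity ?_ ?_)
  · convert (hasSum_theta4 h2x).mul_prod (hasSum_theta4 h2x) using 2 with p
    rw [neg_one_zpow_sub, mul_mul_mul_comm, mul_left_comm, ← Real.exp_add, ← Real.exp_add]
    push_cast
    ring_nf
  · convert (hasSum_alternating_theta2 h2x).mul_prod (hasSum_alternating_theta2 h2x)
      using 2 with p
    rw [neg_one_zpow_sub, mul_mul_mul_comm, mul_left_comm, ← Real.exp_add, ← Real.exp_add]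
    push_cast
    ring_nf

lemma theta2_pos {x : ℝ} (hx : 0 < x) : 0 < theta2 x :=
  (hasSum_theta2 hx).tsum_eq ▸ (hasSum_theta2 hx).summable.tsum_pos (fun _ ↦ (exp_pos _).le) 0
    (exp_pos _)

lemma theta3_pos {x : ℝ} (hx : 0 < x) : 0 < theta3 x :=
  (hasSum_theta3 hx).tsum_eq ▸ (hasSum_theta3 hx).summable.tsum_pos (fun _ ↦ (exp_pos _).le) 0
    (exp_pos _)

lemma theta3_inv_sq {x : ℝ} (hx : 0 < x) : theta3 (1 / x) ^ 2 = x * theta3 x ^ 2 := by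
  have h := evenKernel_functional_equation ((0:ℝ) : UnitAddCircle) (1 / x)
  have h0 : evenKernel ((0:ℝ) : UnitAddCircle) = cosKernel ((0:ℝ) : UnitAddCircle) :=
    evenKernel_eq_cosKernel_of_zero
  rw [← h0, one_div_one_div, ← Real.sqrt_eq_rpow] at h
  change theta3 (1 / x) = _ * theta3 x at h
  rw [h, mul_pow, div_pow, Real.sq_sqrt (by positivity)]
  simp

lemma theta2_inv_sq {x : ℝ} (hx : 0 < x) : theta2 (1 / x) ^ 2 = x * theta4 x ^ 2 := by
  have h := evenKernel_functional_equation ((1 / 2:ℝ) : UnitAddCircle) (1 / x)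
  rw [one_div_one_div, ← Real.sqrt_eq_rpow] at h
  change theta2 (1 / x) = _ * theta4 x at h
  rw [h, mul_pow, div_pow, Real.sq_sqrt (by positivity)]
  simp

lemma theta4_pos {x : ℝ} (hx : 0 < x) : 0 < theta4 x := by
  have h := evenKernel_functional_equation ((1 / 2:ℝ) : UnitAddCircle) (1 / x)
  rw [one_div_one_div, ← Real.sqrt_eq_rpow] at h
  change theta2 (1 / x) = _ * theta4 x at h
  have h2 := theta2_pos (one_div_pos.2 hx)
  rw [h] at h2
  exact pos_of_mul_pos_right h2 (by positivity)

/-- Jacobi's quartic identity. -/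
lemma theta_quartic {x : ℝ} (hx : 0 < x) : theta3 x ^ 4 = theta2 x ^ 4 + theta4 x ^ 4 := by
  have hx2 : 0 < x / 2 := by positivity
  have h1 := theta3_sq hx2
  have h2 := theta4_sq hx2
  have h3 := theta3_mul_theta4 hx2
  rw [mul_div_cancel₀ _ two_ne_zero] at h1 h2 h3
  have h4 : theta4 x ^ 4 = theta3 (x / 2) ^ 2 * theta4 (x / 2) ^ 2 := by
    rw [← mul_pow, h3]
    ring
  rw [h4, h1, h2]
  ring

lemma tendsto_exp_neg_mul {p : ℝ} (hp : 0 < p) : Tendsto (fun x ↦ rexp (-p * x)) atTop (𝓝 0) := by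
  simp only [neg_mul]
  exact tendsto_exp_neg_atTop_nhds_zero.comp (tendsto_id.const_mul_atTop hp)

lemma tendsto_theta3 : Tendsto theta3 atTop (𝓝 1) := by
  obtain ⟨p, hp, h⟩ := isBigO_atTop_evenKernel_sub ((0:ℝ) : UnitAddCircle)
  rw [if_pos (by simp)] at h
  have := (h.trans_tendsto (tendsto_exp_neg_mul hp)).add_const 1
  simp only [sub_add_cancel, zero_add] at this
  exact this

lemma tendsto_theta2 : Tendsto theta2 atTop (𝓝 0) := by
  obtain ⟨p, hp, h⟩ := isBigO_atTop_evenKernel_sub ((1 / 2:ℝ) : UnitAddCircle)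
  have h0 : ((1 / 2:ℝ) : UnitAddCircle) ≠ 0 := by
    rw [Ne, AddCircle.coe_eq_zero_iff]
    rintro ⟨n, hn⟩
    rw [zsmul_one] at hn
    have : (2 * n : ℝ) = 1 := by linarith
    norm_cast at this
    omega
  simp only [if_neg h0, sub_zero] at h
  exact h.trans_tendsto (tendsto_exp_neg_mul hp)

lemma tendsto_theta4 : Tendsto theta4 atTop (𝓝 1) := by
  obtain ⟨p, hp, h⟩ := isBigO_atTop_cosKernel_sub ((1 / 2:ℝ) : UnitAddCircle)
  have := (h.trans_tendsto (tendsto_exp_neg_mul hp)).add_const 1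
  simp only [sub_add_cancel, zero_add] at this
  exact this

/-- The elliptic modulus at `τ = ix`. -/
noncomputable def thetaModulus (x : ℝ) : ℝ := theta2 x ^ 2 / theta3 x ^ 2

lemma tendsto_thetaModulus : Tendsto thetaModulus atTop (𝓝 0) := by
  have := (tendsto_theta2.pow 2).div (tendsto_theta3.pow 2) (by norm_num)
  rwa [zero_pow two_ne_zero, zero_div] at this

lemma sqrt_one_sub_thetaModulus_sq {x : ℝ} (hx : 0 < x) :
    √(1 - thetaModulus x ^ 2) = theta4 x ^ 2 / theta3 x ^ 2 := by
  have h3 := theta3_pos hx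
  rw [Real.sqrt_eq_iff_mul_self_eq_of_pos (div_pos (pow_pos (theta4_pos hx) 2) (by positivity)),
    thetaModulus]
  have := theta_quartic hx
  field_simp
  linear_combination -this

lemma thetaModulus_mem {x : ℝ} (hx : 0 < x) : thetaModulus x ∈ Ioo (0:ℝ) 1 := by
  have h2 := theta2_pos hx
  have h3 := theta3_pos hx
  have h4 := theta4_pos hx
  refine ⟨by unfold thetaModulus; positivity, ?_⟩
  rw [thetaModulus, div_lt_one (by positivity)]
  have := theta_quartic hx
  refine lt_of_pow_lt_pow_left₀ 2 (by positivity) ?_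
  nlinarith [pow_pos h4 4]

lemma thetaModulus_inv {x : ℝ} (hx : 0 < x) : thetaModulus (1 / x) = √(1 - thetaModulus x ^ 2) := by
  rw [sqrt_one_sub_thetaModulus_sq hx, thetaModulus, theta3_inv_sq hx, theta2_inv_sq hx,
    mul_div_mul_left _ _ hx.ne']

lemma agmIntegral_theta {x : ℝ} (hx : 0 < x) :
    agmIntegral (theta3 x ^ 2) (theta4 x ^ 2) = ellipticK (thetaModulus x) / theta3 x ^ 2 := by
  have h3 := pow_pos (theta3_pos hx) 2
  rw [← agmIntegral_eq_ellipticK h3 (thetaModulus_mem hx), sqrt_one_sub_thetaModulus_sq hx,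
    mul_div_cancel₀ _ h3.ne']

lemma agmIntegral_theta_two_mul {x : ℝ} (hx : 0 < x) :
    agmIntegral (theta3 (2 * x) ^ 2) (theta4 (2 * x) ^ 2) =
      agmIntegral (theta3 x ^ 2) (theta4 x ^ 2) := by
  have h3 := theta3_pos hx
  have h4 := theta4_pos hx
  rw [← agmIntegral_landen (pow_pos h3 2) (pow_pos h4 2), ← mul_pow,
    Real.sqrt_sq (by positivity), theta3_mul_theta4 hx, theta3_sq hx, theta4_sq hx]
  ring_nf

lemma ellipticK_thetaModulus {x : ℝ} (hx : 0 < x) :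
    ellipticK (thetaModulus x) = π / 2 * theta3 x ^ 2 := by
  have hn : ∀ n : ℕ, ellipticK (thetaModulus (2 ^ n * x)) / theta3 (2 ^ n * x) ^ 2 =
      ellipticK (thetaModulus x) / theta3 x ^ 2 := by
    intro n
    induction n with
    | zero => simp
    | succ n ih =>
      rw [← ih, ← agmIntegral_theta (by positivity), ← agmIntegral_theta (by positivity),
        pow_succ' (2:ℝ) n, mul_assoc, agmIntegral_theta_two_mul (by positivity)]
  have hlim : Tendsto (fun y ↦ ellipticK (thetaModulus y) / theta3 y ^ 2) atTop (𝓝 (π / 2)) := by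
    have h2 := ((continuousAt_ellipticK (k := 0) (by simp)).tendsto.comp tendsto_thetaModulus).div
      (tendsto_theta3.pow 2) (by norm_num)
    rwa [ellipticK_zero, one_pow, div_one] at h2
  have hseq : Tendsto (fun n : ℕ ↦ (2:ℝ) ^ n * x) atTop atTop :=
    (tendsto_pow_atTop_atTop_of_one_lt one_lt_two).atTop_mul_const hx
  have := tendsto_nhds_unique (hlim.comp hseq)
    (tendsto_const_nhds.congr fun n ↦ (hn n).symm)
  rw [this, div_mul_cancel₀ _ (pow_pos (theta3_pos hx) 2).ne']

lemma xRatio_thetaModulus {x : ℝ} (hx : 0 < x) : xRatio (thetaModulus x) = x := by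
  have := theta3_pos hx
  rw [xRatio, ← thetaModulus_inv hx, ellipticK_thetaModulus hx,
    ellipticK_thetaModulus (one_div_pos.2 hx), theta3_inv_sq hx]
  field_simp

lemma continuousOn_thetaModulus : ContinuousOn thetaModulus (Ioi 0) :=
  ((continuousOn_evenKernel _).pow 2).div ((continuousOn_evenKernel _).pow 2)
    fun _ hx ↦ (pow_pos (theta3_pos hx) 2).ne'

lemma exists_thetaModulus_eq {k : ℝ} (hk : k ∈ Ioo (0:ℝ) 1) : ∃ x, 0 < x ∧ thetaModulus x = k := by
  have h2 : Tendsto (fun x ↦ thetaModulus (1 / x)) atTop (𝓝 1) := by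
    have : Tendsto (fun x ↦ theta4 x ^ 2 / theta3 x ^ 2) atTop (𝓝 1) := by
      have := (tendsto_theta4.pow 2).div (tendsto_theta3.pow 2) (by norm_num)
      rwa [one_pow, div_one] at this
    refine this.congr' ?_
    filter_upwards [eventually_gt_atTop 0] with x hx
    rw [thetaModulus_inv hx, sqrt_one_sub_thetaModulus_sq hx]
  obtain ⟨a, ha, ha0⟩ := ((tendsto_thetaModulus.eventually_lt_const hk.1).and (eventually_gt_atTop 0)).exists
  obtain ⟨b, hb, hb0⟩ := ((h2.eventually_const_lt hk.2).and (eventually_gt_atTop 0)).exists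
  obtain ⟨x, hx, h⟩ := isPreconnected_Ioi.intermediate_value ha0 (mem_Ioi.2 (one_div_pos.2 hb0))
    continuousOn_thetaModulus ⟨ha.le, hb.le⟩
  exact ⟨x, hx, h⟩

lemma hasDerivAt_thetaModulus {x : ℝ} (hx : 0 < x) :
    HasDerivAt thetaModulus (-(2 * thetaModulus x * (1 - thetaModulus x ^ 2) *
      ellipticK (thetaModulus x) ^ 2 / π)) x := by
  have hk := thetaModulus_mem hx
  have hK := ellipticK_pos (abs_lt_one_of_mem_Ioo hk)
  have h1 : 0 < 1 - thetaModulus x ^ 2 := by nlinarith [hk.1, hk.2]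
  have hk0 := hk.1
  convert! HasDerivAt.of_local_left_inverse
    (continuousOn_thetaModulus.continuousAt (Ioi_mem_nhds hx)) (hasDerivAt_xRatio hk)
    (neg_ne_zero.2 (by positivity)) ?_ using 1
  · rw [← neg_inv, inv_div]
  · filter_upwards [Ioi_mem_nhds hx] with y hy using xRatio_thetaModulus hy

end

section

open Set MeasureTheory intervalIntegral Filter Topology
open UpperHalfPlane hiding I
open scoped ModularForm MatrixGroups

/-- The product of the three Jacobi theta constants, as a function on the upper half plane. -/
noncomputable def thetaProd (τ : ℂ) : ℂ :=
  Complex.exp (π * Complex.I * τ / 4) * jacobiTheta₂ (τ / 2) τ * jacobiTheta₂ 0 τ *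
    jacobiTheta₂ (1 / 2) τ

lemma jacobiTheta₂_add_one_right (z τ : ℂ) :
    jacobiTheta₂ z (τ + 1) = jacobiTheta₂ (z + 1 / 2) τ := by
  refine tsum_congr fun n ↦ ?_
  simp only [jacobiTheta₂_term]
  obtain ⟨m, hm⟩ : Even (n ^ 2 - n) := by
    rw [sq, ← mul_sub_one]
    exact Int.even_mul_pred_self n
  have h : (n : ℂ) ^ 2 = m + m + n := by
    have : n ^ 2 = m + m + n := by omega
    exact_mod_cast this
  rw [Complex.exp_eq_exp_iff_exists_int]
  refine ⟨m, ?_⟩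
  linear_combination (π * Complex.I) * h

lemma thetaProd_add_one_pow (τ : ℂ) : thetaProd (τ + 1) ^ 8 = thetaProd τ ^ 8 := by
  have h1 : Complex.exp (π * Complex.I * (τ + 1) / 4) ^ 8 =
      Complex.exp (π * Complex.I * τ / 4) ^ 8 := by
    rw [← Complex.exp_nat_mul, ← Complex.exp_nat_mul, Complex.exp_eq_exp_iff_exists_int]
    refine ⟨1, ?_⟩
    push_cast
    ring
  have h2 : jacobiTheta₂ ((τ + 1) / 2) (τ + 1) = jacobiTheta₂ (τ / 2) τ := by
    rw [jacobiTheta₂_add_one_right, ← jacobiTheta₂_add_left (τ / 2)]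
    ring_nf
  have h3 : jacobiTheta₂ (1 / 2) (τ + 1) = jacobiTheta₂ 0 τ := by
    rw [jacobiTheta₂_add_one_right, ← jacobiTheta₂_add_left 0]
    norm_num
  have h4 : jacobiTheta₂ 0 (τ + 1) = jacobiTheta₂ (1 / 2) τ := by
    rw [jacobiTheta₂_add_one_right, zero_add]
  simp only [thetaProd, h2, h3, h4, mul_pow, h1]
  ring

lemma thetaProd_neg_one_div_pow {τ : ℂ} (hτ : τ ≠ 0) :
    thetaProd (-1 / τ) ^ 8 = τ ^ 12 * thetaProd τ ^ 8 := by
  have hI : -Complex.I * τ ≠ 0 := mul_ne_zero (neg_ne_zero.2 Complex.I_ne_zero) hτ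
  set w := (-Complex.I * τ) ^ (1 / 2 : ℂ) with hw
  have hw2 : w ^ 2 = -Complex.I * τ := by
    rw [hw, ← Complex.cpow_nat_mul]
    norm_num
  have hw0 : w ≠ 0 := fun h ↦ hI (by rw [← hw2, h]; ring)
  have h0 := jacobiTheta₂_functional_equation 0 τ
  have h1 := jacobiTheta₂_functional_equation (1 / 2) τ
  have h2 := jacobiTheta₂_functional_equation (τ / 2) τ
  rw [← hw] at h0 h1 h2
  rw [show (1 / 2 : ℂ) / τ = -(-1 / τ / 2) by ring, jacobiTheta₂_neg_left] at h1
  rw [show τ / 2 / τ = 1 / 2 by field_simp] at h2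
  have e1 : Complex.exp (-π * Complex.I * (1 / 2) ^ 2 / τ) =
      Complex.exp (π * Complex.I * (-1 / τ) / 4) := by ring_nf
  have e2 : Complex.exp (π * Complex.I * τ / 4) *
      Complex.exp (-π * Complex.I * (τ / 2) ^ 2 / τ) = 1 := by
    rw [← Complex.exp_add, Complex.exp_eq_one_iff]
    exact ⟨0, by field_simp; ring⟩
  have key : w ^ 3 * thetaProd τ = thetaProd (-1 / τ) := by
    rw [thetaProd, h0, h1, h2, thetaProd, e1]
    simp only [zero_div, zero_pow two_ne_zero, mul_zero, Complex.exp_zero]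
    rw [← sub_eq_zero]
    have hw3 : w ^ 3 * (1 / w * (1 / w) * (1 / w)) = 1 := by field_simp
    linear_combination (jacobiTheta₂ (1 / 2) (-1 / τ) * jacobiTheta₂ 0 (-1 / τ) *
      Complex.exp (π * Complex.I * (-1 / τ) / 4) * jacobiTheta₂ (-1 / τ / 2) (-1 / τ)) *
      (w ^ 3 * (1 / w * (1 / w) * (1 / w)) * e2 + hw3)
  rw [← key, mul_pow, show (w ^ 3) ^ 8 = (w ^ 2) ^ 12 by ring, hw2, mul_pow, neg_pow,
    show Complex.I ^ 12 = (Complex.I ^ 4) ^ 3 by ring, Complex.I_pow_four]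
  norm_num

lemma differentiableAt_thetaProd {τ : ℂ} (hτ : 0 < τ.im) : DifferentiableAt ℂ thetaProd τ := by
  have h : DifferentiableAt ℂ (fun t : ℂ ↦ jacobiTheta₂ (t / 2) t) τ := by
    have h1 : DifferentiableAt ℂ (fun t : ℂ ↦ (t / 2, t)) τ := by fun_prop
    exact (hasFDerivAt_jacobiTheta₂ (τ / 2) hτ).differentiableAt.comp (f := fun t : ℂ ↦ (t / 2, t)) τ h1
  have h0 := differentiableAt_jacobiTheta₂_snd 0 hτ
  have h2 := differentiableAt_jacobiTheta₂_snd (1 / 2) hτ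
  unfold thetaProd
  fun_prop

lemma exists_norm_thetaProd_le :
    ∃ C : ℝ, ∀ τ : ℂ, 1 ≤ τ.im → ‖thetaProd τ‖ ≤ rexp (-(π / 4) * τ.im) * C := by
  have bound : ∀ z₀ : ℂ, ∃ C : ℝ, 0 ≤ C ∧ ∀ z τ : ℂ, 1 ≤ τ.im →
      (∀ n : ℤ, ‖jacobiTheta₂_term n z τ‖ ≤ ‖jacobiTheta₂_term n z₀ Complex.I‖) →
      ‖jacobiTheta₂ z τ‖ ≤ C := fun z₀ ↦
    ⟨∑' n : ℤ, ‖jacobiTheta₂_term n z₀ Complex.I‖, tsum_nonneg fun _ ↦ norm_nonneg _,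
      fun z τ hτ h ↦ tsum_of_norm_bounded
        ((summable_jacobiTheta₂_term_iff z₀ Complex.I).2 (by simp)).norm.hasSum h⟩
  obtain ⟨A, hA0, hA⟩ := bound 0
  obtain ⟨B, hB0, hB⟩ := bound (Complex.I / 2)
  refine ⟨B * A * A, fun τ hτ ↦ ?_⟩
  have hb : ∀ z : ℂ, z.im = 0 → ‖jacobiTheta₂ z τ‖ ≤ A := fun z hz ↦ by
    refine hA _ _ hτ fun n ↦ ?_
    simp only [norm_jacobiTheta₂_term, hz]
    rw [Real.exp_le_exp]
    simp only [Complex.I_im, Complex.zero_im]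
    nlinarith [mul_nonneg pi_pos.le (sq_nonneg (n : ℝ))]
  have ha : ‖jacobiTheta₂ (τ / 2) τ‖ ≤ B := by
    refine hB _ _ hτ fun n ↦ ?_
    simp only [norm_jacobiTheta₂_term]
    rw [Real.exp_le_exp]
    have hn : (0:ℝ) ≤ n ^ 2 + n := by
      have : 0 ≤ n * (n + 1) := by
        rcases le_or_gt 0 n with h | h
        · positivity
        · exact mul_nonneg_of_nonpos_of_nonpos h.le (by omega)
      have : 0 ≤ n ^ 2 + n := by linarith
      exact_mod_cast this
    simp only [Complex.div_ofNat_im, Complex.I_im]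
    nlinarith [mul_nonneg (mul_nonneg pi_pos.le hn) (sub_nonneg.2 hτ)]
  have he : ‖Complex.exp (π * Complex.I * τ / 4)‖ = rexp (-(π / 4) * τ.im) := by
    rw [Complex.norm_exp]
    congr 1
    simp
    ring
  rw [thetaProd, norm_mul, norm_mul, norm_mul, he, mul_assoc, mul_assoc, mul_assoc B]
  gcongr
  · exact hb 0 (by simp)
  · exact hb (1 / 2) (by simp)

/-- The eighth power of the product of the theta constants is a cusp form of weight `12`. -/
noncomputable def thetaCuspForm : CuspForm 𝒮ℒ 12 :=
  have hT : (fun τ : ℍ ↦ thetaProd τ ^ 8) ∣[(12 : ℤ)] ModularGroup.T =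
      fun τ : ℍ ↦ thetaProd τ ^ 8 := by
    ext z
    rw [ModularForm.SL_slash_apply, modular_T_smul, ModularGroup.denom_apply]
    simp [ModularGroup.T, ← thetaProd_add_one_pow z, add_comm]
  have hS : (fun τ : ℍ ↦ thetaProd τ ^ 8) ∣[(12 : ℤ)] ModularGroup.S =
      fun τ : ℍ ↦ thetaProd τ ^ 8 := by
    ext z
    suffices thetaProd (-(z : ℂ)⁻¹) ^ 8 * ((z : ℂ) ^ 12)⁻¹ = thetaProd z ^ 8 by
      rw [ModularForm.SL_slash_apply, UpperHalfPlane.modular_S_smul]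
      simpa [ModularGroup.denom_S]
    have := thetaProd_neg_one_div_pow z.ne_zero
    rw [neg_div, one_div] at this
    rw [this]
    field_simp [z.ne_zero]
  { toFun := fun τ : ℍ ↦ thetaProd τ ^ 8
    slash_action_eq' := fun A hA ↦ by
      obtain ⟨A, rfl⟩ := hA
      exact SlashInvariantForm.slash_action_generators_SL2Z hS hT A
    holo' := by
      rw [UpperHalfPlane.mdifferentiable_iff]
      refine .congr (fun z hz ↦ ((differentiableAt_thetaProd hz).pow
        8).differentiableWithinAt) fun z hz ↦ ?_
      simp [ofComplex_apply_of_im_pos hz]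
    zero_at_cusps' := fun hc ↦ by
      rw [Subgroup.IsArithmetic.isCusp_iff_isCusp_SL2Z] at hc
      rw [OnePoint.isZeroAt_iff_forall_SL2Z hc]
      intro γ _
      rw [SlashInvariantForm.slash_action_generators_SL2Z hS hT]
      obtain ⟨C, hC⟩ := exists_norm_thetaProd_le
      have hlim : Tendsto (fun τ : ℍ ↦ (rexp (-(π / 4) * τ.im) * C) ^ 8) atImInfty (𝓝 0) := by
        have := (((tendsto_exp_neg_mul (p := π / 4) (by positivity)).comp
          (tendsto_comap : Tendsto UpperHalfPlane.im atImInfty atTop)).mul_const C).pow 8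
        simpa using! this
      refine squeeze_zero_norm' ?_ hlim
      filter_upwards [tendsto_comap.eventually (eventually_ge_atTop 1)] with τ hτ
      rw [norm_pow]
      exact pow_le_pow_left₀ (norm_nonneg _) (hC τ hτ) 8 }

lemma exists_thetaProd_pow_eq :
    ∃ c : ℂ, ∀ τ : ℍ, thetaProd τ ^ 8 = c * ModularForm.eta τ ^ 24 := by
  obtain ⟨c, hc⟩ := CuspForm.exists_smul_discriminant_of_weight_eq_twelve thetaCuspForm
  exact ⟨c, fun τ ↦ (DFunLike.congr_fun hc τ).symm⟩

lemma thetaProd_I_mul {x : ℝ} : thetaProd (Complex.I * x) =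
    ((theta2 x * theta3 x * theta4 x : ℝ) : ℂ) := by
  have h2 := HurwitzZeta.evenKernel_def (1 / 2) x
  have h3 := HurwitzZeta.evenKernel_def 0 x
  have h4 := HurwitzZeta.cosKernel_def (1 / 2) x
  rw [thetaProd, Complex.ofReal_mul, Complex.ofReal_mul, theta2, theta3, theta4, h2, h3, h4]
  push_cast
  congr 3
  · ring_nf
    simp
    ring_nf
  · ring_nf
  · simp

end

section

open Set MeasureTheory intervalIntegral Filter Topology
open UpperHalfPlane hiding I

open scoped ArithmeticFunction.sigma in
lemma tsum_sigma_one_mul_exp_pow {x : ℝ} (hx : 0 < x) :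
    ∑' n : ℕ+, (σ 1 n : ℝ) * rexp (-(2 * π * x)) ^ (n : ℕ) =
      ∑' n : ℕ+, 1 / (4 * sinh (n * π * x) ^ 2) := by
  have hr : ‖rexp (-(2 * π * x))‖ < 1 := by
    rw [Real.norm_of_nonneg (exp_pos _).le, Real.exp_lt_one_iff]
    have := pi_pos
    simp only [Left.neg_neg_iff]
    positivity
  rw [← tsum_prod_pow_eq_tsum_sigma 1 hr]
  refine tsum_congr fun n ↦ ?_
  have hn : 0 < (n : ℝ) * π * x := by
    have := n.pos
    positivity
  have hrn : ‖rexp (-(2 * (n * π * x)))‖ < 1 := by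
    rw [Real.norm_of_nonneg (exp_pos _).le, Real.exp_lt_one_iff]
    linarith
  have h := hasSum_coe_mul_geometric_of_norm_lt_one hrn
  rw [← PNat.coe_injective.hasSum_iff fun m hm ↦ ?_] at h
  · convert h.tsum_eq using 1
    · refine tsum_congr fun m ↦ ?_
      simp only [pow_one, Function.comp_apply, ← Real.exp_nat_mul]
      push_cast
      ring_nf
    · have h1 : sinh (n * π * x) ^ 2 =
          (1 - rexp (-(2 * (n * π * x)))) ^ 2 / (4 * rexp (-(2 * (n * π * x)))) := by
        rw [Real.sinh_eq, show -(2 * (n * π * x)) = -(n * π * x) + -(n * π * x) by ring,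
          Real.exp_add, Real.exp_neg]
        field_simp
        ring
      rw [h1]
      field_simp
  · have : m = 0 := by
      by_contra h0
      exact hm ⟨⟨m, Nat.pos_of_ne_zero h0⟩, rfl⟩
    simp [this]

lemma E2_I_mul {x : ℝ} (hx : 0 < x) (h : 0 < (Complex.I * x).im) :
    EisensteinSeries.E2 ⟨Complex.I * x, h⟩ =
      ((1 - 24 * ∑' n : ℕ+, 1 / (4 * sinh (n * π * x) ^ 2) : ℝ) : ℂ) := by
  rw [EisensteinSeries.E2_eq_tsum_cexp, ← tsum_sigma_one_mul_exp_pow hx]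
  have he : Complex.exp (2 * π * Complex.I * (Complex.I * x)) =
      (rexp (-(2 * π * x)) : ℂ) := by
    push_cast
    congr 1
    linear_combination (2 * π * x) * Complex.I_mul_I
  push_cast
  simp only [he]
  push_cast
  rfl

lemma hasDerivAt_inv_sinh_sq {a y : ℝ} (h : a * y ≠ 0) :
    HasDerivAt (fun x ↦ 1 / (4 * sinh (a * x) ^ 2))
      (-(a / 2) * (cosh (a * y) / sinh (a * y) ^ 3)) y := by
  have hs : sinh (a * y) ≠ 0 := by simpa [Real.sinh_eq_zero] using h
  have h1 : HasDerivAt (fun x ↦ a * x) a y := by simpa using (hasDerivAt_id y).const_mul a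
  have h2 := ((h1.sinh.pow 2).const_mul 4).inv (by simpa using hs)
  simp only [one_div]
  refine h2.congr_deriv ?_
  simp only [Pi.pow_apply]
  field_simp
  ring

lemma sq_div_four_le_sinh {z : ℝ} (hz : 0 ≤ z) : z ^ 2 / 4 ≤ sinh z := by
  rw [Real.sinh_eq]
  have h1 := quadratic_le_exp_of_nonneg hz
  have h2 : rexp (-z) ≤ 1 := Real.exp_le_one_iff.2 (by linarith)
  linarith

lemma cosh_div_sinh_cube_le {z : ℝ} (hz : 0 < z) :
    cosh z / sinh z ^ 3 ≤ 16 / z ^ 4 + 64 / z ^ 6 := by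
  have h1 := sq_div_four_le_sinh hz.le
  have hs : 0 < sinh z := Real.sinh_pos_iff.2 hz
  have hz2 : 0 < z ^ 2 / 4 := by positivity
  have hc : cosh z ≤ sinh z + 1 := by
    have h2 : rexp (-z) ≤ 1 := Real.exp_le_one_iff.2 (by linarith)
    linarith [Real.cosh_sub_sinh z]
  calc cosh z / sinh z ^ 3 ≤ (sinh z + 1) / sinh z ^ 3 := by gcongr
    _ = 1 / sinh z ^ 2 + 1 / sinh z ^ 3 := by field_simp
    _ ≤ 1 / (z ^ 2 / 4) ^ 2 + 1 / (z ^ 2 / 4) ^ 3 := by gcongr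
    _ = 16 / z ^ 4 + 64 / z ^ 6 := by field_simp; ring

lemma hasDerivAt_tsum_inv_sinh_sq {x : ℝ} (hx : 0 < x) :
    HasDerivAt (fun y ↦ ∑' n : ℕ+, 1 / (4 * sinh (n * π * y) ^ 2))
      (-(π / 2) * ∑' n : ℕ+, (n : ℝ) * cosh (n * π * x) / sinh (n * π * x) ^ 3) x := by
  obtain ⟨a, ha, hax⟩ := exists_between hx
  have hpi := pi_pos
  set C := π / 2 * (16 / (π * a) ^ 4 + 64 / (π * a) ^ 6) with hC
  have hpos : ∀ n : ℕ+, ∀ y ∈ Ioi a, 0 < (n : ℝ) * π * y := fun n y hy ↦ by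
    have := n.pos
    have := ha.trans hy
    positivity
  have hsum3 : Summable fun n : ℕ+ ↦ (1 : ℝ) / (n : ℝ) ^ 3 :=
    (Real.summable_one_div_nat_pow.2 (by norm_num : 1 < 3)).comp_injective PNat.coe_injective
  have hsum4 : Summable fun n : ℕ+ ↦ (1 : ℝ) / (n : ℝ) ^ 4 :=
    (Real.summable_one_div_nat_pow.2 (by norm_num : 1 < 4)).comp_injective PNat.coe_injective
  have key := hasDerivAt_tsum_of_isPreconnected (u := fun n : ℕ+ ↦ C * (1 / (n : ℝ) ^ 3))
    (g := fun (n : ℕ+) y ↦ 1 / (4 * sinh (n * π * y) ^ 2))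
    (g' := fun (n : ℕ+) y ↦ -(n * π / 2) * (cosh (n * π * y) / sinh (n * π * y) ^ 3))
    (t := Ioi a) (y₀ := x) (y := x) (hsum3.mul_left C) isOpen_Ioi isPreconnected_Ioi
    (fun n y hy ↦ hasDerivAt_inv_sinh_sq (hpos n y hy).ne') ?_ hax ?_ hax
  · refine key.congr_deriv ?_
    rw [← tsum_mul_left]
    exact tsum_congr fun n ↦ by ring
  · intro n y hy
    have hn : (1 : ℝ) ≤ n := by exact_mod_cast n.pos
    have hz := hpos n y hy
    have hs := Real.sinh_pos_iff.2 hz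
    have hc := Real.cosh_pos (n * π * y)
    rw [Real.norm_eq_abs, neg_mul, abs_neg, abs_of_nonneg (by positivity)]
    have hle : n * (π * a) ≤ n * π * y := by
      rw [mul_assoc]
      have := (mem_Ioi.1 hy).le
      gcongr
    calc n * π / 2 * (cosh (n * π * y) / sinh (n * π * y) ^ 3)
        ≤ n * π / 2 * (16 / (n * π * y) ^ 4 + 64 / (n * π * y) ^ 6) := by
          gcongr
          exact cosh_div_sinh_cube_le hz
      _ ≤ n * π / 2 * (16 / (n * (π * a)) ^ 4 + 64 / (n * (π * a)) ^ 6) := by gcongr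
      _ = π / 2 * (16 / (π * a) ^ 4 * (1 / n ^ 3) +
          64 / (π * a) ^ 6 * (1 / n ^ 3) * (1 / n ^ 2)) := by field_simp
      _ ≤ π / 2 * (16 / (π * a) ^ 4 * (1 / n ^ 3) + 64 / (π * a) ^ 6 * (1 / n ^ 3) * 1) := by
          gcongr
          rw [div_le_one (by positivity)]
          exact one_le_pow₀ hn
      _ = C * (1 / n ^ 3) := by rw [hC]; ring
  · refine .of_nonneg_of_le (fun n ↦ by positivity) (fun n ↦ ?_)
      (hsum4.mul_left (4 / (π * x) ^ 4))
    have hz := hpos n x hax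
    calc 1 / (4 * sinh (n * π * x) ^ 2) ≤ 1 / (4 * ((n * π * x) ^ 2 / 4) ^ 2) := by
          gcongr
          exact sq_div_four_le_sinh hz.le
      _ = 4 / (π * x) ^ 4 * (1 / n ^ 4) := by field_simp

/-- The theta product in terms of elliptic integrals. -/
lemma theta_prod_pow_eq_ellipticK {x : ℝ} (hx : 0 < x) :
    (theta2 x * theta3 x * theta4 x) ^ 8 = thetaModulus x ^ 4 * (1 - thetaModulus x ^ 2) ^ 2 *
      (2 * ellipticK (thetaModulus x) / π) ^ 12 := by
  have h3 := theta3_pos hx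
  have h4 : 1 - thetaModulus x ^ 2 = theta4 x ^ 4 / theta3 x ^ 4 := by
    rw [thetaModulus]
    have := theta_quartic hx
    field_simp
    linear_combination this
  rw [h4, ellipticK_thetaModulus hx, thetaModulus]
  have := pi_pos
  field_simp

lemma hasDerivAt_theta_prod_pow {x : ℝ} (hx : 0 < x) :
    HasDerivAt (fun y ↦ (theta2 y * theta3 y * theta4 y) ^ 8)
      ((theta2 x * theta3 x * theta4 x) ^ 8 * (-(8 / π) * (3 * ellipticE (thetaModulus x) *
        ellipticK (thetaModulus x) + (thetaModulus x ^ 2 - 2) * ellipticK (thetaModulus x) ^ 2)))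
      x := by
  have hk := thetaModulus_mem hx
  have h0 := hk.1
  have h1 : 0 < 1 - thetaModulus x ^ 2 := by nlinarith [hk.1, hk.2]
  have hK := ellipticK_pos (abs_lt_one_of_mem_Ioo hk)
  have dk := hasDerivAt_thetaModulus hx
  have dK := (hasDerivAt_ellipticK (abs_lt_one_of_mem_Ioo hk) hk.1.ne').comp x dk
  have d := ((dk.pow 4).mul (((dk.pow 2).const_sub 1).pow 2)).mul
    (((dK.const_mul 2).div_const π).pow 12)
  refine (d.congr_of_eventuallyEq ?_).congr_deriv ?_
  · filter_upwards [Ioi_mem_nhds hx] with y hy using theta_prod_pow_eq_ellipticK hy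
  · rw [theta_prod_pow_eq_ellipticK hx]
    have := pi_pos
    simp only [Pi.pow_apply, Pi.mul_apply, Function.comp_apply]
    generalize thetaModulus x = k at *
    generalize ellipticK k = K at *
    generalize ellipticE k = E at *
    push_cast
    field_simp
    ring

lemma one_sub_tsum_inv_sinh_sq {x : ℝ} (hx : 0 < x) :
    1 - 24 * ∑' n : ℕ+, 1 / (4 * sinh (n * π * x) ^ 2) =
      4 / π ^ 2 * (3 * ellipticE (thetaModulus x) * ellipticK (thetaModulus x) +
        (thetaModulus x ^ 2 - 2) * ellipticK (thetaModulus x) ^ 2) := by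
  obtain ⟨c, hc⟩ := exists_thetaProd_pow_eq
  have him : ∀ y : ℝ, 0 < y → 0 < (Complex.I * y).im := fun y hy ↦ by simpa using hy
  have heq : ∀ y : ℝ, 0 < y → (((theta2 y * theta3 y * theta4 y) ^ 8 : ℝ) : ℂ) =
      c * ModularForm.eta (Complex.I * y) ^ 24 := fun y hy ↦ by
    have := hc ⟨Complex.I * y, him y hy⟩
    rw [UpperHalfPlane.coe_mk, thetaProd_I_mul] at this
    exact_mod_cast this
  have d1 := (hasDerivAt_theta_prod_pow hx).ofReal_comp
  have hη0 : ModularForm.eta (Complex.I * x) ≠ 0 := ModularForm.eta_ne_zero (him x hx)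
  have hdη := ModularForm.differentiableAt_eta_of_mem_upperHalfPlaneSet (him x hx)
  have hlog := ModularForm.logDeriv_eta_eq_E2 ⟨Complex.I * x, him x hx⟩
  rw [E2_I_mul hx, UpperHalfPlane.coe_mk, logDeriv_apply, div_eq_iff hη0] at hlog
  have dη := hdη.hasDerivAt
  rw [hlog] at dη
  have dI : HasDerivAt (fun y : ℝ ↦ Complex.I * y) Complex.I x := by
    simpa using (Complex.ofRealCLM.hasDerivAt (x := x)).const_mul Complex.I
  have d2 := ((dη.comp x dI).pow 24).const_mul c
  have d3 := d1.congr_of_eventuallyEq (f₁ := fun y : ℝ ↦ c * ModularForm.eta (Complex.I * y) ^ 24)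
    (by filter_upwards [Ioi_mem_nhds hx] with y hy using (heq y hy).symm)
  have huniq := d3.unique d2
  have hpos : (theta2 x * theta3 x * theta4 x) ^ 8 ≠ 0 := by
    have := theta2_pos hx
    have := theta3_pos hx
    have := theta4_pos hx
    positivity
  have hpos' : c * ModularForm.eta (Complex.I * x) ^ 24 ≠ 0 := by
    rw [← heq x hx]
    exact_mod_cast hpos
  rw [Complex.ofReal_mul, heq x hx] at huniq
  have h2 : ((-(8 / π) * (3 * ellipticE (thetaModulus x) * ellipticK (thetaModulus x) +
      (thetaModulus x ^ 2 - 2) * ellipticK (thetaModulus x) ^ 2) : ℝ) : ℂ) =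
      ((-(2 * π) * (1 - 24 * ∑' n : ℕ+, 1 / (4 * sinh (n * π * x) ^ 2)) : ℝ) : ℂ) := by
    refine mul_left_cancel₀ hpos' (huniq.trans ?_)
    rw [Complex.ofReal_mul (-(2 * π))]
    simp only [Function.comp_apply]
    push_cast
    linear_combination (2 * π * c * ModularForm.eta (Complex.I * x) ^ 24 *
      (1 - 24 * ∑' n : ℕ+, 1 / (4 * Complex.sinh (n * π * x) ^ 2))) * Complex.I_mul_I
  have h3 := Complex.ofReal_injective h2
  have := pi_pos
  generalize ∑' n : ℕ+, 1 / (4 * sinh (n * π * x) ^ 2) = S at h3 ⊢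
  field_simp at h3 ⊢
  linarith

lemma hasDerivAt_quasimodular_ellipticK {k : ℝ} (hk : k ∈ Ioo (0:ℝ) 1) :
    HasDerivAt (fun k ↦ 3 * ellipticE k * ellipticK k + (k ^ 2 - 2) * ellipticK k ^ 2)
      (-(2 * ellipticE k * ellipticK k * (2 - k ^ 2) + ellipticK k ^ 2 * (k ^ 2 - 1) -
        3 * ellipticE k ^ 2) / (k * (1 - k ^ 2))) k := by
  have h0 := hk.1
  have h1 : 0 < 1 - k ^ 2 := by nlinarith [hk.1, hk.2]
  have dK := hasDerivAt_ellipticK (abs_lt_one_of_mem_Ioo hk) hk.1.ne'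
  have dE := hasDerivAt_ellipticE (abs_lt_one_of_mem_Ioo hk) hk.1.ne'
  have d := ((dE.const_mul 3).mul dK).add ((((hasDerivAt_id k).pow 2).sub_const 2).mul (dK.pow 2))
  refine d.congr_deriv ?_
  simp only [Pi.pow_apply, id]
  push_cast
  field_simp
  ring

end

/-- Closed form of the hyperbolic series appearing in the second lattice sum. -/
theorem T2_series_closed_form (k : ℝ) (hk : k ∈ Set.Ioo (0:ℝ) 1) :
    4 * π ^ 3 * xRatio k ^ 2 *
      (∑' n : ℕ+, (n : ℝ) * Real.cosh (n * π * xRatio k) /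
        Real.sinh (n * π * xRatio k) ^ 3) =
      (8 / (3 * π)) * ellipticK (Real.sqrt (1 - k ^ 2)) ^ 2 *
        (2 * ellipticE k * ellipticK k * (2 - k ^ 2) +
          ellipticK k ^ 2 * (k ^ 2 - 1) - 3 * ellipticE k ^ 2) := by
  obtain ⟨x, hx, rfl⟩ := exists_thetaModulus_eq hk
  have hK := ellipticK_pos (abs_lt_one_of_mem_Ioo hk)
  have hK' : ellipticK √(1 - thetaModulus x ^ 2) = x * ellipticK (thetaModulus x) := by
    rw [← div_eq_iff hK.ne']
    exact xRatio_thetaModulus hx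
  have d1 := ((hasDerivAt_tsum_inv_sinh_sq hx).const_mul 24).const_sub 1
  have d2 := ((hasDerivAt_quasimodular_ellipticK hk).comp x
    (hasDerivAt_thetaModulus hx)).const_mul (4 / π ^ 2)
  have huniq := d1.unique (d2.congr_of_eventuallyEq (by
    filter_upwards [Ioi_mem_nhds hx] with y hy using one_sub_tsum_inv_sinh_sq hy))
  rw [xRatio_thetaModulus hx, hK']
  have h0 := hk.1
  have h1 : 0 < 1 - thetaModulus x ^ 2 := by nlinarith [hk.1, hk.2]
  have := pi_pos
  generalize ∑' n : ℕ+, (n : ℝ) * cosh (n * π * x) / sinh (n * π * x) ^ 3 = T at *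
  generalize thetaModulus x = k at *
  generalize ellipticK k = K at *
  generalize ellipticE k = E at *
  field_simp at huniq ⊢
  linear_combination (1 / 2) * huniq
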